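/- arXiv:1606.01530 — 3 statements merged into one kernel-verified Lean document; each statement's English description precedes it below -/
import Mathlib

section
/- Let a, x : ℕ → ℝ be finitely supported nonnegative sequences (there exists N with a(k) = x(k) = 0 for all k ≥ N) satisfying a(0) ≤ 1 and a(k) ≤ 0.2·a(k−1) + 3·x(k) for all k ≥ 1. Let L > 0 and let C be a real number with C ≥ 1 and C ≥ (1/2)·Σ_{k≥1} 2^{k−1}·x(k). Then L·Σ_{k≥0} 2^k·a(k) + L ≤ (136/6)·L·C. -/
/-- Arithmetic core of the main approximation theorem: if `a, x : ℕ → ℝ` are finitely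
supported nonnegative sequences with `a 0 ≤ 1` and `a k ≤ 0.2 a (k-1) + 3 x k` for all
`k ≥ 1` (written with `k = j + 1`), `L > 0`, and `C ≥ 1` with
`C ≥ (1/2) ∑_{k ≥ 1} 2^(k-1) x k` (reindexed as `k = j + 1`), then
`L ∑_{k ≥ 0} 2^k a k + L ≤ (136/6) L C`. -/
theorem stmt_2 (a x : ℕ → ℝ) (hfin : ∃ N : ℕ, ∀ k ≥ N, a k = 0 ∧ x k = 0)
    (ha_nonneg : ∀ k, 0 ≤ a k) (hx_nonneg : ∀ k, 0 ≤ x k) (ha0 : a 0 ≤ 1)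
    (hrec : ∀ j : ℕ, a (j + 1) ≤ 0.2 * a j + 3 * x (j + 1))
    (L : ℝ) (hL : 0 < L) (C : ℝ) (hC1 : 1 ≤ C)
    (hCx : (1 / 2) * (∑' j : ℕ, (2 : ℝ) ^ j * x (j + 1)) ≤ C) :
    L * (∑' k : ℕ, (2 : ℝ) ^ k * a k) + L ≤ (136 / 6) * L * C := by
  obtain ⟨N, hN⟩ := hfin
  have sum_a : Summable fun k : ℕ => (2 : ℝ) ^ k * a k :=
    summable_of_ne_finset_zero (s := Finset.range N) fun k hk => by
      rw [(hN k (by simpa using hk)).1, mul_zero]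
  have sum_x : Summable fun j : ℕ => (2 : ℝ) ^ j * x (j + 1) :=
    summable_of_ne_finset_zero (s := Finset.range N) fun k hk => by
      have : N ≤ k := by simpa using hk
      rw [(hN (k + 1) (by lia)).2, mul_zero]
  have split := sum_a.tsum_eq_zero_add
  have tail_le : ∑' k : ℕ, (2 : ℝ) ^ (k + 1) * a (k + 1) ≤
      0.4 * (∑' k : ℕ, (2 : ℝ) ^ k * a k) + 6 * ∑' j : ℕ, (2 : ℝ) ^ j * x (j + 1) := by
    rw [← tsum_mul_left, ← tsum_mul_left,
      ← (sum_a.mul_left 0.4).tsum_add (sum_x.mul_left 6)]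
    refine ((summable_nat_add_iff 1).2 sum_a).tsum_le_tsum (fun k => ?_)
      ((sum_a.mul_left 0.4).add (sum_x.mul_left 6))
    calc (2 : ℝ) ^ (k + 1) * a (k + 1)
        ≤ 2 ^ (k + 1) * (0.2 * a k + 3 * x (k + 1)) := by gcongr; exact hrec k
      _ = 0.4 * (2 ^ k * a k) + 6 * (2 ^ k * x (k + 1)) := by ring
  have bound : (∑' k : ℕ, (2 : ℝ) ^ k * a k) + 1 ≤ 136 / 6 * C := by
    rw [pow_zero, one_mul] at split
    linarith
  calc L * (∑' k : ℕ, (2 : ℝ) ^ k * a k) + L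
      = L * ((∑' k : ℕ, (2 : ℝ) ^ k * a k) + 1) := by ring
    _ ≤ L * (136 / 6 * C) := by gcongr
    _ = 136 / 6 * L * C := by ring
end

section
/- Let f be a real-valued function on finite subsets of a ground set U that is monotone (f(A) ≤ f(B) whenever A ⊆ B), submodular (f(A) + f(B) ≥ f(A ∪ B) + f(A ∩ B) for all A, B), satisfies f(∅) = 0 and 0 ≤ f(S) ≤ 1 for all S, and suppose there exists ε with 0 < ε ≤ 1 such that for every set E and element e, if f(E ∪ {e}) > f(E) then f(E ∪ {e}) − f(E) ≥ ε. Let e₁, …, e_T be any sequence of elements and let E_t = {e₁, …, e_t} denote its prefixes (E₀ = ∅). Then Σ_{t ∈ {1,…,T} : f(E_{t−1}) < 1} (f(E_t) − f(E_{t−1})) / (1 − f(E_{t−1})) ≤ 1 + ln(1/ε). -/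
/-- For a sequence `a` in `(-∞, 1]` with `a 0 = 0` whose increments are zero or at least `ε`, the
normalized increments sum to at most `1 + log (1 / ε)`, and to at most `-log (1 - a T)` as long as
`a T < 1`. -/
theorem sum_normalized_increments_le (a : ℕ → ℝ) (ha0 : a 0 = 0) (ha1 : ∀ t, a t ≤ 1)
    (ε : ℝ) (hε0 : 0 < ε) (hε1 : ε ≤ 1)
    (hstep : ∀ t, a (t + 1) = a t ∨ ε ≤ a (t + 1) - a t) (T : ℕ) :
    ∑ t ∈ (Finset.range T).filter (fun t => a t < 1), (a (t + 1) - a t) / (1 - a t)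
        ≤ 1 + Real.log (1 / ε) ∧
      (a T < 1 →
        ∑ t ∈ (Finset.range T).filter (fun t => a t < 1), (a (t + 1) - a t) / (1 - a t)
          ≤ -Real.log (1 - a T)) := by
  simp only [Finset.sum_filter]
  rw [one_div, Real.log_inv]
  induction T with
  | zero =>
    have := Real.log_nonpos hε0.le hε1
    simp only [Finset.range_zero, Finset.sum_empty, ha0, sub_zero, Real.log_one, neg_zero]
    exact ⟨by linarith, fun _ => le_rfl⟩
  | succ T ih =>
    obtain ⟨hbound, hlog⟩ := ih
    rw [Finset.sum_range_succ]
    rcases hstep T with heq | hinc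
    · simpa [heq] using And.intro hbound hlog
    · have hlt : a T < 1 := by linarith [ha1 (T + 1)]
      have hr : 0 < 1 - a T := by linarith
      have hsum := hlog hlt
      rw [if_pos hlt]
      constructor
      · have hterm : (a (T + 1) - a T) / (1 - a T) ≤ 1 := by
          rw [div_le_one hr]
          linarith [ha1 (T + 1)]
        have := Real.log_le_log hε0 (show ε ≤ 1 - a T by linarith [ha1 (T + 1)])
        linarith
      · intro hlt'
        have hr' : 0 < 1 - a (T + 1) := by linarith
        have hle := Real.log_le_sub_one_of_pos (div_pos hr' hr)
        rw [Real.log_div hr'.ne' hr.ne'] at hle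
        have hterm : (a (T + 1) - a T) / (1 - a T) = 1 - (1 - a (T + 1)) / (1 - a T) := by
          field_simp
          ring
        linarith


/-- Chain bound (Claim 2.1 of Azar–Gamzu): for a monotone submodular `f` with values
in `[0,1]`, `f ∅ = 0`, and all positive marginals at least `ε ∈ (0,1]`, along any
sequence of elements `e 1, …, e T` with prefix sets `E t = {e 1, …, e t}` we have
`∑_{t ∈ [1,T], f (E (t-1)) < 1} (f (E t) - f (E (t-1)))/(1 - f (E (t-1))) ≤ 1 + ln (1/ε)`. -/
theorem stmt_6 {α : Type*} [DecidableEq α] (f : Finset α → ℝ)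
    (hmono : ∀ A B : Finset α, A ⊆ B → f A ≤ f B)
    (hsub : ∀ A B : Finset α, f (A ∪ B) + f (A ∩ B) ≤ f A + f B)
    (hempty : f ∅ = 0) (hrange : ∀ S : Finset α, 0 ≤ f S ∧ f S ≤ 1)
    (ε : ℝ) (hε0 : 0 < ε) (hε1 : ε ≤ 1)
    (hgap : ∀ (E : Finset α) (e : α), f (insert e E) > f E → ε ≤ f (insert e E) - f E)
    (T : ℕ) (e : ℕ → α) :
    let E : ℕ → Finset α := fun t => (Finset.range t).image e
    ∑ t ∈ (Finset.range T).filter (fun t => f (E t) < 1),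
        (f (E (t + 1)) - f (E t)) / (1 - f (E t)) ≤ 1 + Real.log (1 / ε) := by
  intro E
  refine (sum_normalized_increments_le (fun t => f (E t)) (by simpa [E] using hempty)
    (fun t => (hrange _).2) ε hε0 hε1 (fun t => ?_) T).1
  have hE : E (t + 1) = insert (e t) (E t) := by
    simp [E, Finset.range_add_one, Finset.image_insert]
  simp only [hE]
  rcases (hmono _ _ (Finset.subset_insert (e t) (E t))).eq_or_lt with h | h
  · exact Or.inl h.symm
  · exact Or.inr (hgap _ _ h)
end

section
/- Let J be a finite index set and for each j ∈ J let f_j be a real-valued function on finite subsets of a ground set that is monotone (f_j(A) ≤ f_j(B) whenever A ⊆ B), submodular (f_j(A) + f_j(B) ≥ f_j(A ∪ B) + f_j(A ∩ B) for all A, B), and takes values in [0, 1]. Then the function h(S) = 1 − Π_{j ∈ J} (1 − f_j(S)) is monotone and submodular. -/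
/-- The product of two nonnegative, antitone, supermodular value patterns on
`A ∪ B`, `A`, `B`, `A ∩ B` is again supermodular. -/
theorem mul_add_mul_le_of_supermodular {u a b i u' a' b' i' : ℝ}
    (hu : 0 ≤ u) (hua : u ≤ a) (hub : u ≤ b) (h : a + b ≤ u + i)
    (hu' : 0 ≤ u') (hua' : u' ≤ a') (hub' : u' ≤ b') (h' : a' + b' ≤ u' + i') :
    a * a' + b * b' ≤ u * u' + i * i' := by
  have hi : (a + b - u) * (a' + b' - u') ≤ i * i' :=
    mul_le_mul (by linarith) (by linarith) (by linarith) (by linarith)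
  nlinarith [mul_nonneg (sub_nonneg.2 hua) (sub_nonneg.2 hub'),
    mul_nonneg (sub_nonneg.2 hub) (sub_nonneg.2 hua')]

/-- A finite product of nonnegative, antitone, supermodular value patterns on
`A ∪ B`, `A`, `B`, `A ∩ B` is supermodular. -/
theorem Finset.prod_add_prod_le_of_supermodular {ι : Type*} (J : Finset ι)
    {u a b i : ι → ℝ} (hu : ∀ j ∈ J, 0 ≤ u j) (hua : ∀ j ∈ J, u j ≤ a j)
    (hub : ∀ j ∈ J, u j ≤ b j) (h : ∀ j ∈ J, a j + b j ≤ u j + i j) :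
    ∏ j ∈ J, a j + ∏ j ∈ J, b j ≤ ∏ j ∈ J, u j + ∏ j ∈ J, i j := by
  classical
  induction J using Finset.induction_on with
  | empty => simp
  | insert k s hk ih =>
    simp only [Finset.forall_mem_insert] at hu hua hub h
    simp only [Finset.prod_insert hk]
    exact mul_add_mul_le_of_supermodular hu.1 hua.1 hub.1 h.1
      (Finset.prod_nonneg hu.2) (Finset.prod_le_prod hu.2 hua.2)
      (Finset.prod_le_prod hu.2 hub.2) (ih hu.2 hua.2 hub.2 h.2)

/-- OR of submodular functions: if each `f j` (for `j` in a finite index set `J`) is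
monotone, submodular and `[0,1]`-valued, then `h S = 1 - ∏_{j ∈ J} (1 - f j S)` is
monotone and submodular. -/
theorem stmt_11 {α ι : Type*} [DecidableEq α] (J : Finset ι) (f : ι → Finset α → ℝ)
    (hmono : ∀ j ∈ J, ∀ A B : Finset α, A ⊆ B → f j A ≤ f j B)
    (hsub : ∀ j ∈ J, ∀ A B : Finset α, f j (A ∪ B) + f j (A ∩ B) ≤ f j A + f j B)
    (hrange : ∀ j ∈ J, ∀ S : Finset α, 0 ≤ f j S ∧ f j S ≤ 1) :
    let h : Finset α → ℝ := fun S => 1 - ∏ j ∈ J, (1 - f j S)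
    (∀ A B : Finset α, A ⊆ B → h A ≤ h B) ∧
      (∀ A B : Finset α, h (A ∪ B) + h (A ∩ B) ≤ h A + h B) := by
  intro h
  refine ⟨fun A B hAB => ?_, fun A B => ?_⟩
  · exact sub_le_sub_left (Finset.prod_le_prod
      (fun j hj => sub_nonneg.2 (hrange j hj B).2)
      (fun j hj => sub_le_sub_left (hmono j hj A B hAB) 1)) 1
  · have key := Finset.prod_add_prod_le_of_supermodular J
      (u := fun j => 1 - f j (A ∪ B)) (a := fun j => 1 - f j A)
      (b := fun j => 1 - f j B) (i := fun j => 1 - f j (A ∩ B))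
      (fun j hj => sub_nonneg.2 (hrange j hj _).2)
      (fun j hj => sub_le_sub_left (hmono j hj _ _ Finset.subset_union_left) 1)
      (fun j hj => sub_le_sub_left (hmono j hj _ _ Finset.subset_union_right) 1)
      (fun j hj => by linarith [hsub j hj A B])
    simp only [h]
    linarith
end
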